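/- Let β ≥ α > 2. There exists an even function H ∈ C¹(ℝ; [0,+∞)) such that: (i) H(u) ≤ min{|u|^β, |u|^α} for all u ∈ ℝ; (ii) H is convex; (iii) lim_{u→0} H(u)|u|^{−β} = 1; (iv) lim_{|u|→∞} H(u)|u|^{−α} = 1; (v) min{t^α, t^β} H(u) ≤ H(tu) ≤ max{t^α, t^β} H(u) for all u ∈ ℝ and t ≥ 0. -/

import Mathlib

open Filter Topology

noncomputable def wF (u : ℝ) : ℝ := |u| / (1 + |u|)

lemma wF_nonneg (u : ℝ) : 0 ≤ wF u := by unfold wF; positivity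

lemma wF_le_one (u : ℝ) : wF u ≤ 1 := by
  unfold wF
  rw [div_le_one (by positivity)]; linarith

lemma wF_le_abs (u : ℝ) : wF u ≤ |u| := by
  unfold wF
  exact div_le_self (abs_nonneg u) (by linarith [abs_nonneg u])

lemma wF_cont : Continuous wF := by
  unfold wF
  exact continuous_abs.div (by fun_prop) (fun u => by positivity)

lemma wF_mono {u v : ℝ} (h : |u| ≤ |v|) : wF u ≤ wF v := by
  unfold wF
  have := abs_nonneg u
  rw [div_le_div_iff₀ (by positivity) (by positivity)]
  nlinarith

noncomputable def HF (α γ : ℝ) (u : ℝ) : ℝ := |u| ^ α * wF u ^ γ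

noncomputable def gF (α γ : ℝ) (u : ℝ) : ℝ :=
  |u| ^ (α - 2) * wF u ^ γ * (α * u + γ * (u / (1 + |u|)))

lemma HF_even (α γ u : ℝ) : HF α γ (-u) = HF α γ u := by simp [HF, wF]

lemma gF_cont (α γ : ℝ) (hα : 2 < α) (hγ : 0 ≤ γ) : Continuous (gF α γ) := by
  unfold gF
  refine ((continuous_abs.rpow_const fun u => Or.inr (by linarith)).mul
    (wF_cont.rpow_const fun u => Or.inr hγ)).mul ?_
  exact (by fun_prop : Continuous fun u : ℝ => α * u).add
    (continuous_const.mul (continuous_id.div (by fun_prop) (fun u => by positivity)))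

lemma HF_cont (α γ : ℝ) (hα : 2 < α) (hγ : 0 ≤ γ) : Continuous (HF α γ) := by
  unfold HF
  exact (continuous_abs.rpow_const fun u => Or.inr (by linarith)).mul
    (wF_cont.rpow_const fun u => Or.inr hγ)

lemma HF_deriv_pos (α γ u : ℝ) (hu : 0 < u) : HasDerivAt (HF α γ) (gF α γ u) u := by
  have h1 : HasDerivAt (fun x : ℝ => x ^ α * (x / (1 + x)) ^ γ)
      ((α * u ^ (α - 1)) * (u / (1 + u)) ^ γ +
        u ^ α * (((1 * (1 + u) - u * 1) / (1 + u) ^ 2) * γ * (u / (1 + u)) ^ (γ - 1))) u := by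
    refine (Real.hasDerivAt_rpow_const (Or.inl hu.ne')).mul ?_
    refine HasDerivAt.rpow_const ?_ (Or.inl (by positivity))
    exact (hasDerivAt_id u).div ((hasDerivAt_id u).const_add 1) (by simp; positivity)
  have h2 : HF α γ =ᶠ[𝓝 u] (fun x : ℝ => x ^ α * (x / (1 + x)) ^ γ) := by
    filter_upwards [lt_mem_nhds hu] with x hx
    simp [HF, wF, abs_of_pos hx]
  refine (h1.congr_of_eventuallyEq h2).congr_deriv ?_
  simp only [gF, wF, abs_of_pos hu]
  have hw : 0 < u / (1 + u) := by positivity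
  rw [Real.rpow_sub_one hw.ne', Real.rpow_sub_one hu.ne', Real.rpow_sub hu]
  generalize (u / (1 + u)) ^ γ = A
  simp only [Real.rpow_ofNat]
  field_simp
  ring

lemma gF_odd (α γ u : ℝ) : gF α γ (-u) = - gF α γ u := by
  simp [gF, wF]; ring

lemma HF_deriv (α γ : ℝ) (hα : 2 < α) (hγ : 0 ≤ γ) (u : ℝ) :
    HasDerivAt (HF α γ) (gF α γ u) u := by
  have key : ∀ y : ℝ, y ≠ 0 → HasDerivAt (HF α γ) (gF α γ y) y := by
    intro y hy
    rcases lt_or_gt_of_ne hy with h | h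
    · have h1 := HF_deriv_pos α γ (-y) (by linarith)
      have h2 := h1.scomp y (hasDerivAt_neg y)
      have h3 : HF α γ ∘ (fun x => -x) = HF α γ := by
        funext x; exact HF_even α γ x
      have h4 : HasDerivAt (HF α γ ∘ (fun x => -x)) ((-1 : ℝ) • gF α γ (-y)) y := h2
      rw [h3] at h4
      refine h4.congr_deriv ?_
      simp [gF_odd]
    · exact HF_deriv_pos α γ y h
  by_cases hu : u = 0
  · subst hu
    exact hasDerivAt_of_hasDerivAt_of_ne key (HF_cont α γ hα hγ).continuousAt
      (gF_cont α γ hα hγ).continuousAt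
  · exact key u hu

lemma gF_mono (α γ : ℝ) (hα : 2 < α) (hγ : 0 ≤ γ) : Monotone (gF α γ) := by
  apply monotone_of_odd_of_monotoneOn_nonneg (gF_odd α γ)
  intro x hx y hy hxy
  have hx : 0 ≤ x := hx
  have hy : 0 ≤ y := hy
  have hab : |x| ≤ |y| := by rwa [abs_of_nonneg hx, abs_of_nonneg hy]
  have hw := wF_mono hab
  have hwx := wF_nonneg x
  have hwy := wF_nonneg y
  have e : ∀ z : ℝ, 0 ≤ z → gF α γ z = |z| ^ (α - 2) * wF z ^ γ * (α * z + γ * wF z) := by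
    intro z hz
    simp [gF, wF, abs_of_nonneg hz]
  rw [e x hx, e y hy]
  have h1 : |x| ^ (α - 2) ≤ |y| ^ (α - 2) :=
    Real.rpow_le_rpow (abs_nonneg x) hab (by linarith)
  have h2 : wF x ^ γ ≤ wF y ^ γ := Real.rpow_le_rpow hwx hw hγ
  have h3 : α * x + γ * wF x ≤ α * y + γ * wF y := by
    have := mul_le_mul_of_nonneg_left hw hγ
    nlinarith
  have h4 : 0 ≤ α * x + γ * wF x := by
    have := mul_nonneg hγ hwx
    nlinarith
  exact mul_le_mul (mul_le_mul h1 h2 (by positivity) (by positivity)) h3 h4 (by positivity)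


/-- Lemma B.1 of the paper.
Let `β ≥ α > 2`.  There exists an even `C¹` function `H : ℝ → [0,∞)` such that
(i) `H u ≤ min (|u|^β) (|u|^α)` for all `u`; (ii) `H` is convex;
(iii) `H u * |u|⁻ᵝ → 1` as `u → 0`; (iv) `H u * |u|⁻ᵅ → 1` as `|u| → ∞`;
(v) `min (t^α) (t^β) * H u ≤ H (t*u) ≤ max (t^α) (t^β) * H u` for `t ≥ 0`. -/
theorem statement13 (α β : ℝ) (hα : 2 < α) (hαβ : α ≤ β) :
    ∃ H : ℝ → ℝ,
      (∀ u : ℝ, H (-u) = H u) ∧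
      ContDiff ℝ 1 H ∧
      (∀ u : ℝ, 0 ≤ H u) ∧
      (∀ u : ℝ, H u ≤ min (|u| ^ β) (|u| ^ α)) ∧
      ConvexOn ℝ Set.univ H ∧
      Tendsto (fun u : ℝ => H u * |u| ^ (-β)) (𝓝[≠] (0 : ℝ)) (𝓝 1) ∧
      Tendsto (fun u : ℝ => H u * |u| ^ (-α))
        (Filter.comap (fun u : ℝ => |u|) Filter.atTop) (𝓝 1) ∧
      (∀ (u t : ℝ), 0 ≤ t →
        min (t ^ α) (t ^ β) * H u ≤ H (t * u) ∧
        H (t * u) ≤ max (t ^ α) (t ^ β) * H u) := by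
  have hγ : 0 ≤ β - α := by linarith
  set γ := β - α with hγd
  have hβ : β = α + γ := by rw [hγd]; ring
  have hd : deriv (HF α γ) = gF α γ := funext fun u => (HF_deriv α γ hα hγ u).deriv
  have hdiff : Differentiable ℝ (HF α γ) := fun u => (HF_deriv α γ hα hγ u).differentiableAt
  have h0 : ∀ u, 0 ≤ HF α γ u := fun u =>
    mul_nonneg (Real.rpow_nonneg (abs_nonneg u) _) (Real.rpow_nonneg (wF_nonneg u) _)
  refine ⟨HF α γ, HF_even α γ, ?_, h0, ?_, ?_, ?_, ?_, ?_⟩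
  · rw [contDiff_one_iff_deriv, hd]
    exact ⟨hdiff, gF_cont α γ hα hγ⟩
  · intro u
    have ha : 0 ≤ |u| ^ α := Real.rpow_nonneg (abs_nonneg u) _
    refine le_min ?_ ?_
    · rw [hβ, Real.rpow_add_of_nonneg (abs_nonneg u) (by linarith) hγ]
      exact mul_le_mul_of_nonneg_left
        (Real.rpow_le_rpow (wF_nonneg u) (wF_le_abs u) hγ) ha
    · exact mul_le_of_le_one_right ha (Real.rpow_le_one (wF_nonneg u) (wF_le_one u) hγ)
  · apply Monotone.convexOn_univ_of_deriv hdiff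
    rw [hd]; exact gF_mono α γ hα hγ
  · have hc : Continuous fun u : ℝ => ((1 + |u|)⁻¹) ^ γ :=
      ((by fun_prop : Continuous fun u : ℝ => 1 + |u|).inv₀
        (fun u => by positivity)).rpow_const fun u => Or.inr hγ
    have ht : Tendsto (fun u : ℝ => ((1 + |u|)⁻¹) ^ γ) (𝓝[≠] (0 : ℝ)) (𝓝 1) := by
      have := hc.tendsto 0
      simp only [abs_zero, add_zero, inv_one, Real.one_rpow] at this
      exact this.mono_left nhdsWithin_le_nhds
    refine ht.congr' ?_
    filter_upwards [self_mem_nhdsWithin] with u hu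
    have hu : 0 < |u| := abs_pos.mpr hu
    have hp := Real.rpow_pos_of_pos hu α
    have hp2 := Real.rpow_pos_of_pos hu γ
    simp only [HF, wF]
    rw [div_eq_mul_inv, Real.mul_rpow hu.le (by positivity), Real.rpow_neg hu.le, hβ,
      Real.rpow_add hu]
    field_simp
  · have hw : Tendsto (fun u : ℝ => (1 - (1 + |u|)⁻¹) ^ γ)
        (Filter.comap (fun u : ℝ => |u|) Filter.atTop) (𝓝 1) := by
      have h1 : Tendsto (fun x : ℝ => (1 - (1 + x)⁻¹) ^ γ) atTop (𝓝 1) := by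
        have h2 : Tendsto (fun x : ℝ => 1 - (1 + x)⁻¹) atTop (𝓝 (1 - 0)) :=
          tendsto_const_nhds.sub
            (tendsto_inv_atTop_zero.comp (tendsto_atTop_add_const_left _ 1 tendsto_id))
        have h3 := h2.rpow_const (p := γ) (Or.inr hγ)
        simpa using h3
      exact h1.comp tendsto_comap
    refine hw.congr' ?_
    filter_upwards [tendsto_comap.eventually (eventually_gt_atTop (0 : ℝ))] with u hu
    have hp := Real.rpow_pos_of_pos hu α
    have e : 1 - (1 + |u|)⁻¹ = wF u := by
      unfold wF; field_simp; ring
    rw [e, HF, Real.rpow_neg hu.le]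
    field_simp
  · intro u t ht
    have ha : 0 ≤ |u| ^ α := Real.rpow_nonneg (abs_nonneg u) _
    have hta : 0 ≤ t ^ α := Real.rpow_nonneg ht _
    have hwu := wF_nonneg u
    have hwt := wF_nonneg (t * u)
    have hu := abs_nonneg u
    have hab : |t * u| = t * |u| := by rw [abs_mul, abs_of_nonneg ht]
    have eH : HF α γ (t * u) = t ^ α * |u| ^ α * wF (t * u) ^ γ := by
      rw [HF, hab, Real.mul_rpow ht hu]
    have eβ : t ^ β = t ^ α * t ^ γ := by
      rw [hβ, Real.rpow_add_of_nonneg ht (by linarith) hγ]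
    have ea : t ^ α * HF α γ u = t ^ α * |u| ^ α * wF u ^ γ := by rw [HF]; ring
    have eb : t ^ β * HF α γ u = t ^ α * |u| ^ α * (t * wF u) ^ γ := by
      rw [HF, eβ, Real.mul_rpow ht hwu]; ring
    have hm : 0 ≤ t ^ α * |u| ^ α := mul_nonneg hta ha
    have ew : wF (t * u) = t * |u| / (1 + t * |u|) := by rw [wF, hab]
    have ew2 : t * wF u = t * |u| / (1 + |u|) := by rw [wF]; ring
    have htu : 0 ≤ t * |u| := mul_nonneg ht hu
    rcases le_total t 1 with h | h
    · have l1 : t * wF u ≤ wF (t * u) := by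
        rw [ew, ew2]
        gcongr
        nlinarith
      have l2 : wF (t * u) ≤ wF u := wF_mono (by rw [hab]; nlinarith)
      constructor
      · refine (mul_le_mul_of_nonneg_right (min_le_right _ _) (h0 u)).trans ?_
        rw [eb, eH]
        exact mul_le_mul_of_nonneg_left (Real.rpow_le_rpow (by positivity) l1 hγ) hm
      · refine le_trans ?_ (mul_le_mul_of_nonneg_right (le_max_left _ _) (h0 u))
        rw [ea, eH]
        exact mul_le_mul_of_nonneg_left (Real.rpow_le_rpow (by positivity) l2 hγ) hm
    · have l1 : wF (t * u) ≤ t * wF u := by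
        rw [ew, ew2]
        gcongr
        nlinarith
      have l2 : wF u ≤ wF (t * u) := wF_mono (by rw [hab]; nlinarith)
      constructor
      · refine (mul_le_mul_of_nonneg_right (min_le_left _ _) (h0 u)).trans ?_
        rw [ea, eH]
        exact mul_le_mul_of_nonneg_left (Real.rpow_le_rpow (by positivity) l2 hγ) hm
      · refine le_trans ?_ (mul_le_mul_of_nonneg_right (le_max_right _ _) (h0 u))
        rw [eb, eH]
        exact mul_le_mul_of_nonneg_left (Real.rpow_le_rpow (by positivity) l1 hγ) hm
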